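/- Let m ≥ 1, let b₁, …, b_n be Hermitian matrices in M = Matrix (Fin m) (Fin m) ℂ, let τ(a) = trace(a)/m, and let Ψ(a) = ((τ a).re, (τ(b₁a)).re, …, (τ(b_na)).re) ∈ ℝ^{n+1}. Let q⁻ ≤ q⁺ be Hermitian idempotent matrices (projections) in M with r = q⁺ − q⁻ ≠ 0, and let F = Ψ({a ∈ M : a − q⁻ and q⁺ − a are positive semidefinite}). Then: (1) F has dimension one (Module.finrank ℝ (affineSpan ℝ F).direction = 1) if and only if for every i there is a real number sᵢ with r·bᵢ·r = sᵢ•r; (2) if F has dimension two (Module.finrank ℝ (affineSpan ℝ F).direction = 2), then the compressions r·bᵢ·r commute pairwise: (r·bᵢ·r)·(r·bⱼ·r) = (r·bⱼ·r)·(r·bᵢ·r) for all i, j. -/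

import Mathlib

open ComplexOrder

/-- The map `Ψ(a) = (Re τ(a), Re τ(b₁a), …, Re τ(bₙa))`, where `τ(a) = trace(a)/m`
is the normalized trace on `Matrix (Fin m) (Fin m) ℂ`. -/
noncomputable def spectralScaleMap {m n : ℕ} (b : Fin n → Matrix (Fin m) (Fin m) ℂ)
    (a : Matrix (Fin m) (Fin m) ℂ) : EuclideanSpace ℝ (Fin (n + 1)) :=
  (WithLp.equiv 2 (Fin (n + 1) → ℝ)).symm
    (Fin.cons ((a.trace / m).re) (fun j => (((b j * a).trace / m).re)))

open scoped Matrix.Norms.L2Operator MatrixOrder in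
/-- A Hermitian matrix is bounded above by a positive multiple of the identity. -/
theorem Matrix.IsHermitian.exists_pos_smul_one_sub_posSemidef {m : ℕ}
    {c : Matrix (Fin m) (Fin m) ℂ} (hc : c.IsHermitian) :
    ∃ t : ℝ, 0 < t ∧ (t • (1 : Matrix (Fin m) (Fin m) ℂ) - c).PosSemidef := by
  have h1 : c ≤ algebraMap ℝ _ ‖c‖ := IsSelfAdjoint.le_algebraMap_norm_self (a := c) hc
  refine ⟨‖c‖ + 1, by positivity, ?_⟩
  rw [Matrix.le_iff, Algebra.algebraMap_eq_smul_one] at h1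
  have h2 : (‖c‖ + 1) • (1 : Matrix (Fin m) (Fin m) ℂ) - c = ‖c‖ • 1 - c + 1 := by
    rw [add_smul, one_smul]; abel
  rw [h2]
  exact h1.add Matrix.PosSemidef.one

open scoped Matrix.Norms.L2Operator MatrixOrder in
theorem Matrix.PosSemidef.exists_eq_conjTranspose_mul_self {m : ℕ}
    {x : Matrix (Fin m) (Fin m) ℂ} (hx : x.PosSemidef) :
    ∃ B : Matrix (Fin m) (Fin m) ℂ, x = B.conjTranspose * B :=
  CStarAlgebra.nonneg_iff_eq_star_mul_self.1 (Matrix.nonneg_iff_posSemidef.2 hx)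

/-- If `0 ≤ x ≤ y` and `y * e = 0`, then `x * e = 0`. -/
theorem Matrix.PosSemidef.mul_eq_zero_of_le {m : ℕ} {x y e : Matrix (Fin m) (Fin m) ℂ}
    (hx : x.PosSemidef) (hxy : (y - x).PosSemidef) (hye : y * e = 0) : x * e = 0 := by
  obtain ⟨B, rfl⟩ := hx.exists_eq_conjTranspose_mul_self
  have h1 := (hxy.conjTranspose_mul_mul_same e).trace_nonneg
  have h2 := (Matrix.posSemidef_conjTranspose_mul_self (B * e)).trace_nonneg
  have h3 : e.conjTranspose * (y - B.conjTranspose * B) * e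
      = -((B * e).conjTranspose * (B * e)) := by
    rw [mul_assoc, sub_mul, hye, Matrix.conjTranspose_mul]
    simp only [mul_assoc, zero_sub, mul_neg]
  rw [h3, Matrix.trace_neg] at h1
  have h4 := le_antisymm (neg_nonneg.1 h1) h2
  rw [Matrix.trace_conjTranspose_mul_self_eq_zero_iff] at h4
  rw [mul_assoc, h4, mul_zero]

/-- A Hermitian matrix whose square has trace with vanishing real part is zero. -/
theorem Matrix.IsHermitian.eq_zero_of_re_trace_mul_self {m : ℕ}
    {x : Matrix (Fin m) (Fin m) ℂ} (hx : x.IsHermitian) (h : ((x * x).trace).re = 0) :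
    x = 0 := by
  have h2 := (Matrix.posSemidef_conjTranspose_mul_self x).trace_nonneg
  rw [← Matrix.trace_conjTranspose_mul_self_eq_zero_iff]
  rw [hx.eq] at h2 ⊢
  exact Complex.ext h (Complex.nonneg_iff.1 h2).2.symm

/-- `spectralScaleMap` as a real-linear map. -/
noncomputable def spectralScaleLinearMap {m n : ℕ} (b : Fin n → Matrix (Fin m) (Fin m) ℂ) :
    Matrix (Fin m) (Fin m) ℂ →ₗ[ℝ] EuclideanSpace ℝ (Fin (n + 1)) where
  toFun := spectralScaleMap b
  map_add' x y := by
    ext k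
    refine Fin.cases ?_ (fun j => ?_) k <;>
      simp [spectralScaleMap, Matrix.mul_add, Matrix.trace_add, add_div]
  map_smul' t x := by
    ext k
    refine Fin.cases ?_ (fun j => ?_) k <;>
      simp [spectralScaleMap, Matrix.trace_smul, mul_div_assoc]

theorem spectralScaleLinearMap_apply {m n : ℕ} (b : Fin n → Matrix (Fin m) (Fin m) ℂ)
    (a : Matrix (Fin m) (Fin m) ℂ) : spectralScaleLinearMap b a = spectralScaleMap b a := rfl

theorem spectralScaleMap_zero_coord {m n : ℕ} (b : Fin n → Matrix (Fin m) (Fin m) ℂ)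
    (a : Matrix (Fin m) (Fin m) ℂ) : spectralScaleMap b a 0 = a.trace.re / m := by
  simp [spectralScaleMap]

theorem spectralScaleMap_succ_coord {m n : ℕ} (b : Fin n → Matrix (Fin m) (Fin m) ℂ)
    (a : Matrix (Fin m) (Fin m) ℂ) (i : Fin n) :
    spectralScaleMap b a i.succ = (b i * a).trace.re / m := by
  simp [spectralScaleMap]

/-- The real span of the projection `r` and the compressions `r * b i * r`. -/
noncomputable def compressionSpan {m n : ℕ} (r : Matrix (Fin m) (Fin m) ℂ)
    (b : Fin n → Matrix (Fin m) (Fin m) ℂ) : Submodule ℝ (Matrix (Fin m) (Fin m) ℂ) :=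
  Submodule.span ℝ (insert r (Set.range fun i => r * b i * r))

section Compression

variable {m n : ℕ} {r : Matrix (Fin m) (Fin m) ℂ} {b : Fin n → Matrix (Fin m) (Fin m) ℂ}

theorem mem_compressionSpan_self : r ∈ compressionSpan r b :=
  Submodule.subset_span (Set.mem_insert _ _)

theorem mem_compressionSpan (i : Fin n) : r * b i * r ∈ compressionSpan r b :=
  Submodule.subset_span (Set.mem_insert_of_mem _ ⟨i, rfl⟩)

theorem isHermitian_and_compress_of_mem (hr : r.IsHermitian) (hrr : r * r = r)
    (hb : ∀ i, (b i).IsHermitian) {x : Matrix (Fin m) (Fin m) ℂ}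
    (hx : x ∈ compressionSpan r b) : x.IsHermitian ∧ r * x * r = x := by
  induction hx using Submodule.span_induction with
  | mem x h =>
    rcases h with rfl | ⟨i, rfl⟩
    · exact ⟨hr, by rw [hrr, hrr]⟩
    · constructor
      · have := Matrix.isHermitian_conjTranspose_mul_mul r (hb i)
        rwa [hr.eq] at this
      · calc r * (r * b i * r) * r = (r * r) * b i * (r * r) := by simp only [mul_assoc]
          _ = r * b i * r := by rw [hrr]
  | zero => simp
  | add x y _ _ hx hy => exact ⟨hx.1.add hy.1, by rw [mul_add, add_mul, hx.2, hy.2]⟩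
  | smul t x _ hx =>
    refine ⟨?_, by rw [mul_smul_comm, smul_mul_assoc, hx.2]⟩
    rw [Matrix.IsHermitian, Matrix.conjTranspose_smul, hx.1.eq, star_trivial]

theorem mul_left_of_compress (hrr : r * r = r) {x : Matrix (Fin m) (Fin m) ℂ}
    (hx : r * x * r = x) : r * x = x := by
  rw [← hx, ← mul_assoc, ← mul_assoc, hrr]

theorem trace_compress_mul {x : Matrix (Fin m) (Fin m) ℂ}
    (hx : r * x * r = x) (c : Matrix (Fin m) (Fin m) ℂ) :
    (r * c * r * x).trace = (c * x).trace := by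
  calc (r * c * r * x).trace = (r * (c * r * x)).trace := by simp only [mul_assoc]
    _ = (c * r * x * r).trace := Matrix.trace_mul_comm _ _
    _ = (c * (r * x * r)).trace := by simp only [mul_assoc]
    _ = (c * x).trace := by rw [hx]

theorem spectralScaleLinearMap_injOn (hm : 1 ≤ m) (hr : r.IsHermitian) (hrr : r * r = r)
    (hb : ∀ i, (b i).IsHermitian) {x : Matrix (Fin m) (Fin m) ℂ}
    (hx : x ∈ compressionSpan r b) (h : spectralScaleMap b x = 0) : x = 0 := by
  have hm' : (m : ℝ) ≠ 0 := by positivity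
  obtain ⟨hxh, hxr⟩ := isHermitian_and_compress_of_mem hr hrr hb hx
  have key : ∀ y ∈ compressionSpan r b, ((y * x).trace).re = 0 := by
    intro y hy
    induction hy using Submodule.span_induction with
    | mem y hy =>
      rcases hy with rfl | ⟨i, rfl⟩
      · have := spectralScaleMap_zero_coord b x
        rw [mul_left_of_compress hrr hxr]
        simpa [h, hm'] using this.symm
      · have := spectralScaleMap_succ_coord b x i
        simp only [trace_compress_mul hxr]
        simpa [h, hm'] using this.symm
    | zero => simp
    | add y z _ _ hy hz => simp [add_mul, hy, hz]
    | smul t y _ hy => simp [Matrix.trace_smul, hy]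
  exact hxh.eq_zero_of_re_trace_mul_self (key x hx)

/-- The direction of the image of an order interval contains the image of the
compression span. -/
theorem spectralScaleMap_mem_direction {qm qp : Matrix (Fin m) (Fin m) ℂ}
    (hrq : r = qp - qm) (hr : r.IsHermitian) (hrr : r * r = r)
    {c : Matrix (Fin m) (Fin m) ℂ} (hc : c.IsHermitian) (hcr : r * c * r = c) :
    spectralScaleMap b c ∈ (affineSpan ℝ (spectralScaleMap b ''
      {a : Matrix (Fin m) (Fin m) ℂ | (a - qm).PosSemidef ∧ (qp - a).PosSemidef})).direction := by
  have hrp : r.PosSemidef := by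
    have := Matrix.posSemidef_conjTranspose_mul_self r
    rwa [hr.eq, hrr] at this
  obtain ⟨t, ht, h1⟩ := hc.exists_pos_smul_one_sub_posSemidef
  have h2 : (t • r - c).PosSemidef := by
    have := h1.conjTranspose_mul_mul_same r
    rwa [hr.eq, mul_sub, sub_mul, hcr, mul_smul_comm, smul_mul_assoc, mul_one, hrr] at this
  obtain ⟨u, hu, h1'⟩ := hc.neg.exists_pos_smul_one_sub_posSemidef
  have h2' : (u • r + c).PosSemidef := by
    have := h1'.conjTranspose_mul_mul_same r
    rwa [hr.eq, mul_sub, sub_mul, mul_neg, neg_mul, hcr, mul_smul_comm, smul_mul_assoc, mul_one,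
      hrr, sub_neg_eq_add] at this
  have hs : t + u ≠ 0 := by positivity
  have hs' : (0 : ℝ) ≤ (t + u)⁻¹ := by positivity
  have e1 : (u * (t + u)⁻¹) • r = r - (t * (t + u)⁻¹) • r := by
    rw [eq_sub_iff_add_eq, ← add_smul, ← add_mul, add_comm u, mul_inv_cancel₀ hs, one_smul]
  have mem1 : qm + (u * (t + u)⁻¹) • r + (t + u)⁻¹ • c ∈
      {a : Matrix (Fin m) (Fin m) ℂ | (a - qm).PosSemidef ∧ (qp - a).PosSemidef} := by
    constructor
    · convert h2'.smul hs' using 1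
      rw [smul_add, smul_smul, mul_comm u]; abel
    · convert h2.smul hs' using 1
      rw [smul_sub, smul_smul, e1, hrq, mul_comm t]; abel
  have mem2 : qm + (u * (t + u)⁻¹) • r ∈
      {a : Matrix (Fin m) (Fin m) ℂ | (a - qm).PosSemidef ∧ (qp - a).PosSemidef} := by
    constructor
    · convert hrp.smul (show 0 ≤ u * (t + u)⁻¹ by positivity) using 1
      abel
    · convert hrp.smul (show 0 ≤ t * (t + u)⁻¹ by positivity) using 1
      rw [e1, hrq]; abel
  have h3 := AffineSubspace.vsub_mem_direction
    (subset_affineSpan ℝ _ (Set.mem_image_of_mem (spectralScaleMap b) mem1))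
    (subset_affineSpan ℝ _ (Set.mem_image_of_mem (spectralScaleMap b) mem2))
  rw [vsub_eq_sub, ← spectralScaleLinearMap_apply, ← spectralScaleLinearMap_apply, ← map_sub,
    add_sub_cancel_left, map_smul] at h3
  have h4 := Submodule.smul_mem _ (t + u) h3
  rwa [smul_smul, mul_inv_cancel₀ hs, one_smul] at h4

theorem finrank_compressionSpan_le {qm qp : Matrix (Fin m) (Fin m) ℂ} (hm : 1 ≤ m)
    (hrq : r = qp - qm) (hr : r.IsHermitian) (hrr : r * r = r) (hb : ∀ i, (b i).IsHermitian) :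
    Module.finrank ℝ (compressionSpan r b) ≤ Module.finrank ℝ (affineSpan ℝ (spectralScaleMap b ''
      {a : Matrix (Fin m) (Fin m) ℂ | (a - qm).PosSemidef ∧ (qp - a).PosSemidef})).direction := by
  have hinj : Function.Injective ((spectralScaleLinearMap b).domRestrict (compressionSpan r b)) := by
    rw [injective_iff_map_eq_zero]
    rintro ⟨x, hx⟩ h
    exact Subtype.ext (spectralScaleLinearMap_injOn hm hr hrr hb hx h)
  rw [← LinearMap.finrank_range_of_inj hinj]
  refine Submodule.finrank_mono ?_
  rintro _ ⟨⟨x, hx⟩, rfl⟩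
  obtain ⟨hxh, hxr⟩ := isHermitian_and_compress_of_mem hr hrr hb hx
  exact spectralScaleMap_mem_direction hrq hr hrr hxh hxr

end Compression

/-- Noncommuting elements fixed by left and right multiplication by `r` are linearly
independent together with `r`. -/
theorem linearIndependent_of_not_commute {A : Type*} [Ring A] [Algebra ℝ A] {r x y : A}
    (hr : r ≠ 0) (hrx : r * x = x) (hxr : x * r = x) (hry : r * y = y) (hyr : y * r = y)
    (hxy : x * y ≠ y * x) : LinearIndependent ℝ ![r, x, y] := by
  rw [Fintype.linearIndependent_iff]
  intro g hg
  simp only [Fin.sum_univ_three, Matrix.cons_val_zero, Matrix.cons_val_one, Matrix.cons_val] at hg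
  have hsub : x * y - y * x ≠ 0 := sub_ne_zero.2 hxy
  have hx2 : g 2 • (x * y - y * x) = 0 := by
    have h1 := congrArg (fun z => x * z - z * x) hg
    simpa [mul_add, add_mul, mul_smul_comm, smul_mul_assoc, hrx, hxr, smul_sub] using h1
  have hy1 : g 1 • (x * y - y * x) = 0 := by
    have h1 := congrArg (fun z => z * y - y * z) hg
    simpa [mul_add, add_mul, mul_smul_comm, smul_mul_assoc, hry, hyr, smul_sub] using h1
  have g2 : g 2 = 0 := (smul_eq_zero.1 hx2).resolve_right hsub
  have g1 : g 1 = 0 := (smul_eq_zero.1 hy1).resolve_right hsub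
  rw [g1, g2, zero_smul, zero_smul, add_zero, add_zero] at hg
  have g0 : g 0 = 0 := (smul_eq_zero.1 hg).resolve_right hr
  intro i
  fin_cases i <;> assumption

theorem stmt14 {m n : ℕ} (hm : 1 ≤ m) (b : Fin n → Matrix (Fin m) (Fin m) ℂ)
    (hb : ∀ i, (b i).IsHermitian)
    (qm qp : Matrix (Fin m) (Fin m) ℂ)
    (hqmHerm : qm.IsHermitian) (hqpHerm : qp.IsHermitian)
    (hqmProj : qm * qm = qm) (hqpProj : qp * qp = qp)
    (hle : (qp - qm).PosSemidef)
    (r : Matrix (Fin m) (Fin m) ℂ) (hr : r = qp - qm) (hrne : r ≠ 0)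
    (F : Set (EuclideanSpace ℝ (Fin (n + 1))))
    (hF : F = spectralScaleMap b ''
      {a : Matrix (Fin m) (Fin m) ℂ | (a - qm).PosSemidef ∧ (qp - a).PosSemidef}) :
    (Module.finrank ℝ (affineSpan ℝ F).direction = 1 ↔
      ∀ i, ∃ s : ℝ, r * b i * r = (s : ℂ) • r) ∧
    (Module.finrank ℝ (affineSpan ℝ F).direction = 2 →
      ∀ i j, (r * b i * r) * (r * b j * r) = (r * b j * r) * (r * b i * r)) := by
  have hqm : qm.PosSemidef := by
    have := Matrix.posSemidef_conjTranspose_mul_self qm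
    rwa [hqmHerm.eq, hqmProj] at this
  have hmp : qm * qp = qm := by
    have := hqm.mul_eq_zero_of_le (e := 1 - qp) hle (by rw [mul_sub, mul_one, hqpProj, sub_self])
    rwa [mul_sub, mul_one, sub_eq_zero, eq_comm] at this
  have hpm : qp * qm = qm := by
    have := congrArg Matrix.conjTranspose hmp
    rwa [Matrix.conjTranspose_mul, hqmHerm.eq, hqpHerm.eq] at this
  have hrH : r.IsHermitian := hr ▸ hqpHerm.sub hqmHerm
  have hrr : r * r = r := by
    rw [hr, sub_mul, mul_sub, mul_sub, hqpProj, hqmProj, hmp, hpm, sub_self, sub_zero]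
  have hrank : Module.finrank ℝ (compressionSpan r b) ≤
      Module.finrank ℝ (affineSpan ℝ F).direction :=
    hF ▸ finrank_compressionSpan_le hm hr hrH hrr hb
  have hpos : 0 < Module.finrank ℝ (compressionSpan r b) :=
    Module.finrank_pos_iff_exists_ne_zero.2
      ⟨⟨r, mem_compressionSpan_self⟩, fun h => hrne (congrArg Subtype.val h)⟩
  refine ⟨⟨fun h i => ?_, fun h => le_antisymm ?_ (hpos.trans_le hrank)⟩, fun h i j => ?_⟩
  · have h1 : Module.finrank ℝ (compressionSpan r b) = 1 := by omega
    obtain ⟨s, hs⟩ := (finrank_eq_one_iff_of_nonzero'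
      (⟨r, mem_compressionSpan_self⟩ : compressionSpan r b)
      (fun h => hrne (congrArg Subtype.val h))).1 h1 ⟨_, mem_compressionSpan i⟩
    exact ⟨s, (congrArg Subtype.val hs).symm⟩
  · choose s hs using h
    set v : EuclideanSpace ℝ (Fin (n + 1)) := WithLp.toLp 2 (Fin.cons 1 s) with hv
    have hmem : ∀ a : Matrix (Fin m) (Fin m) ℂ, (a - qm).PosSemidef → (qp - a).PosSemidef →
        spectralScaleMap b (a - qm) ∈ Submodule.span ℝ {v} := by
      intro a ha ha'
      have hxr : (a - qm) * r = a - qm := by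
        have := ha.mul_eq_zero_of_le (y := r) (e := 1 - r)
          (by convert ha' using 1; rw [hr]; abel) (by rw [mul_sub, mul_one, hrr, sub_self])
        rwa [mul_sub, mul_one, sub_eq_zero, eq_comm] at this
      have hrx : r * (a - qm) = a - qm := by
        have := congrArg Matrix.conjTranspose hxr
        rwa [Matrix.conjTranspose_mul, ha.1.eq, hrH.eq] at this
      refine Submodule.mem_span_singleton.2 ⟨(a - qm).trace.re / m, ?_⟩
      ext k
      refine Fin.cases ?_ (fun i => ?_) k
      · rw [spectralScaleMap_zero_coord]; simp [hv]
      · rw [spectralScaleMap_succ_coord,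
          ← trace_compress_mul (r := r) (by rw [hrx, hxr]) (b i), hs, smul_mul_assoc, hrx,
          Matrix.trace_smul]
        simp only [hv, PiLp.smul_apply, Fin.cons_succ, smul_eq_mul, Complex.re_ofReal_mul]
        ring
    have hle' : (affineSpan ℝ F).direction ≤ Submodule.span ℝ {v} := by
      rw [direction_affineSpan, vectorSpan_def, Submodule.span_le, hF]
      rintro _ ⟨_, ⟨a, ha, rfl⟩, _, ⟨a', ha', rfl⟩, rfl⟩
      have := Submodule.sub_mem _ (hmem a ha.1 ha.2) (hmem a' ha'.1 ha'.2)
      rwa [← spectralScaleLinearMap_apply, ← spectralScaleLinearMap_apply, ← map_sub,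
        sub_sub_sub_cancel_right, map_sub] at this
    exact (Submodule.finrank_mono hle').trans (by simpa using finrank_span_le_card ({v} : Set (EuclideanSpace ℝ (Fin (n + 1)))))
  · by_contra hne
    have hl : ∀ i, r * (r * b i * r) = r * b i * r := fun i => by
      rw [← mul_assoc, ← mul_assoc, hrr]
    have hr' : ∀ i, r * b i * r * r = r * b i * r := fun i => by rw [mul_assoc, hrr]
    have hli := linearIndependent_of_not_commute hrne (hl i) (hr' i) (hl j) (hr' j) hne
    have h3 := finrank_span_eq_card hli
    have h4 : Submodule.span ℝ (Set.range ![r, r * b i * r, r * b j * r]) ≤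
        compressionSpan r b := by
      rw [Submodule.span_le]
      rintro _ ⟨k, rfl⟩
      fin_cases k
      exacts [mem_compressionSpan_self, mem_compressionSpan i, mem_compressionSpan j]
    have h5 := Submodule.finrank_mono h4
    rw [h3, Fintype.card_fin] at h5
    omega
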